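/- Let L be a finite geometric lattice, and let (R_{xy})_{x≤y∈L} be a family of polynomials in ℤ[t] satisfying: (i) R_{xx}(t) = 1 for all x ∈ L; (ii) deg R_{xy} < rk[x,y]/2 for all x < y; and (iii) for all x < z, t^{rk[x,z]}·R_{xz}(1/t) = Σ_{x≤y≤z} χ̄_{xy}(t)·R_{yz}(t) in ℤ[t], where χ̄_{xy}(t) = Σ_{x≤w≤y} μ(x,w)·t^{rk[x,w]} is the inverse kernel of χ. (These are the right Kazhdan–Lusztig–Stanley polynomials of the kernel χ̄; up to the sign (−1)^{rk[x,y]} they are the inverse Kazhdan–Lusztig polynomials of the intervals of L.) Then for all x ≤ y, every coefficient of the polynomial (−1)^{rk[x,y]}·R_{xy} is nonnegative. -/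

import Mathlib

open IncidenceAlgebra Polynomial in
/-- A finite-interval sum rule together with the normalization on the diagonal determines the
Möbius function. -/
theorem eq_mu_of_sum_Icc_eq_zero {P : Type*} [PartialOrder P] [LocallyFiniteOrder P]
    [DecidableEq P] (μ : P → P → ℤ) (hμ_refl : ∀ x, μ x x = 1)
    (hμ_sum : ∀ x y, x < y → ∑ w ∈ Finset.Icc x y, μ x w = 0) (x : P) :
    ∀ y, x ≤ y → μ x y = mu ℤ x y := by
  suffices ∀ (k : ℕ) (y : P), (Finset.Icc x y).card = k → x ≤ y → μ x y = mu ℤ x y from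
    fun y => this _ y rfl
  intro k
  induction k using Nat.strong_induction_on with
  | _ k ih =>
    intro y hk hxy
    rcases hxy.eq_or_lt with rfl | hlt
    · simp [hμ_refl]
    · have hμ := hμ_sum x y hlt
      rw [Finset.Icc_eq_cons_Ico hxy, Finset.sum_cons] at hμ
      rw [mu_eq_neg_sum_Ico_of_ne hlt.ne, eq_neg_iff_add_eq_zero, ← hμ]
      congr 1
      refine Finset.sum_congr rfl fun w hw => ?_
      obtain ⟨hxw, hwy⟩ := Finset.mem_Ico.1 hw
      refine (ih _ ?_ w rfl hxw).symm
      rw [← hk]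
      refine Finset.card_lt_card (Finset.ssubset_iff_of_subset
        (Finset.Icc_subset_Icc_right hwy.le) |>.2 ⟨y, by simp [hxy], by simp [hwy.not_ge]⟩)

/-- A function on a locally finite order which increases by one along covers is strictly
monotone. -/
theorem strictMono_of_covBy_eq_add_one {P : Type*} [PartialOrder P] [LocallyFiniteOrder P]
    {rk : P → ℕ} (hrk : ∀ x y, x ⋖ y → rk y = rk x + 1) : StrictMono rk :=
  (strictMono_iff_forall_covBy rk).2 fun x y hxy => by simp [hrk x y hxy]

open IncidenceAlgebra in
/-- Weisner's theorem, in its join form. -/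
theorem sum_mu_filter_sup_eq_zero {P : Type*} [Lattice P] [LocallyFiniteOrder P]
    [DecidableEq P] {x a : P} (hxa : x < a) :
    ∀ y, a ≤ y → ∑ w ∈ Finset.Icc x y with w ⊔ a = y, mu ℤ x w = 0 := by
  suffices ∀ (k : ℕ) (y : P), (Finset.Icc x y).card = k → a ≤ y →
      ∑ w ∈ Finset.Icc x y with w ⊔ a = y, mu ℤ x w = 0 from fun y => this _ y rfl
  intro k
  induction k using Nat.strong_induction_on with
  | _ k ih =>
    intro y hk hay
    have hmaps : ∀ w ∈ Finset.Icc x y, w ⊔ a ∈ Finset.Icc a y := fun w hw =>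
      Finset.mem_Icc.2 ⟨le_sup_right, sup_le (Finset.mem_Icc.1 hw).2 hay⟩
    have hsum := Finset.sum_fiberwise_of_maps_to hmaps (fun w => mu ℤ x w)
    rw [sum_Icc_mu_right, if_neg (hxa.trans_le hay).ne, Finset.sum_eq_single y] at hsum
    · exact hsum
    · intro v hv hvy
      obtain ⟨hav, hvy'⟩ := Finset.mem_Icc.1 hv
      have hxv := hxa.le.trans hav
      rw [← ih (Finset.Icc x v).card ?_ v rfl hav]
      · refine Finset.sum_congr ?_ fun _ _ => rfl
        ext w
        simp only [Finset.mem_filter, Finset.mem_Icc]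
        constructor
        · rintro ⟨⟨h1, -⟩, rfl⟩
          exact ⟨⟨h1, le_sup_left⟩, rfl⟩
        · rintro ⟨⟨h1, h2⟩, h3⟩
          exact ⟨⟨h1, h2.trans hvy'⟩, h3⟩
      · rw [← hk]
        refine Finset.card_lt_card (Finset.ssubset_iff_of_subset
          (Finset.Icc_subset_Icc_right hvy') |>.2 ⟨y, by simp [hxv.trans hvy'], ?_⟩)
        simp only [Finset.mem_Icc, not_and]
        exact fun _ h => hvy (le_antisymm hvy' h)
    · intro h
      exact absurd (Finset.mem_Icc.2 ⟨hay, le_rfl⟩) h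

open IncidenceAlgebra in
/-- Rota's sign theorem: the Möbius function of an upper semimodular lattice alternates in sign
with the rank. -/
theorem neg_one_pow_mul_mu_nonneg {P : Type*} [Lattice P] [LocallyFiniteOrder P]
    [DecidableEq P] (hsemi : ∀ a b : P, a ⊓ b ⋖ b → a ⋖ a ⊔ b)
    {rk : P → ℕ} (hrk : ∀ x y, x ⋖ y → rk y = rk x + 1) {x : P} :
    ∀ y, x ≤ y → 0 ≤ (-1 : ℤ) ^ (rk y - rk x) * mu ℤ x y := by
  suffices ∀ (k : ℕ) (y : P), rk y = k → x ≤ y → 0 ≤ (-1 : ℤ) ^ (rk y - rk x) * mu ℤ x y from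
    fun y => this _ y rfl
  have hmono := strictMono_of_covBy_eq_add_one hrk
  intro k
  induction k using Nat.strong_induction_on with
  | _ k ih =>
    intro y hk hxy
    rcases hxy.eq_or_lt with rfl | hlt
    · simp
    obtain ⟨a, hxa, hay⟩ := hlt.exists_covby_le
    have hW := sum_mu_filter_sup_eq_zero hxa.lt y hay
    rw [← Finset.add_sum_erase _ _ (a := y) (by simp [hxy, hay]), ← eq_neg_iff_add_eq_zero] at hW
    rw [hW, ← Finset.sum_neg_distrib, Finset.mul_sum]
    refine Finset.sum_nonneg fun w hw => ?_
    simp only [Finset.mem_erase, Finset.mem_filter, Finset.mem_Icc] at hw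
    obtain ⟨hwy, ⟨hxw, -⟩, hsup⟩ := hw
    have hwa : w ⊓ a = x := by
      refine (hxa.eq_or_eq (le_inf hxw hxa.le) inf_le_right).resolve_right fun h => hwy ?_
      rw [← hsup, sup_eq_left.2 (inf_eq_right.1 h)]
    have hcov : w ⋖ y := hsup ▸ hsemi w a (hwa ▸ hxa)
    have hrw := hrk _ _ hcov
    have hle := hmono.monotone hxw
    have := ih (rk w) (by omega) w rfl hxw
    rw [hrw, Nat.sub_add_comm hle, pow_succ]
    linarith

namespace Polynomial

/-- A polynomial of degree less than `n / 2` that equals its own `n`-reversal vanishes. -/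
theorem eq_zero_of_reflect_eq_self {S : Type*} [Semiring S] {p : S[X]} {n : ℕ}
    (hdeg : ∀ i, n ≤ 2 * i → p.coeff i = 0) (hp : reflect n p = p) : p = 0 := by
  ext i
  rw [coeff_zero]
  by_cases hi : n ≤ 2 * i
  · exact hdeg i hi
  · rw [← hp, coeff_reflect, revAt_le (by omega)]
    exact hdeg _ (by omega)

end Polynomial

open IncidenceAlgebra Polynomial in
/-- Convolving the inverse kernel `χ̄` with the Möbius function yields the reversed Möbius
function. -/
theorem sum_inverse_kernel_mul_mu {P : Type*} [PartialOrder P] [LocallyFiniteOrder P]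
    [DecidableEq P] (rk : P → ℕ) {x z : P} (hxz : x ≤ z) :
    ∑ y ∈ Finset.Icc x z,
        (∑ w ∈ Finset.Icc x y, C (mu ℤ x w) * X ^ (rk w - rk x)) * C (mu ℤ y z) =
      C (mu ℤ x z) * X ^ (rk z - rk x) := by
  simp_rw [Finset.sum_mul]
  rw [Finset.sum_comm' (t' := Finset.Icc x z) (s' := fun w => Finset.Icc w z)]
  · simp_rw [← Finset.mul_sum, ← map_sum, sum_Icc_mu_left]
    simp [apply_ite, hxz]
  · intro y w
    simp only [Finset.mem_Icc]
    constructor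
    · rintro ⟨⟨-, h1⟩, h2, h3⟩
      exact ⟨⟨h3, h1⟩, h2, h3.trans h1⟩
    · rintro ⟨⟨h1, h2⟩, h3, -⟩
      exact ⟨⟨h3.trans h1, h2⟩, h3, h1⟩

open IncidenceAlgebra Polynomial in
/-- The right Kazhdan–Lusztig–Stanley polynomials of the inverse kernel `χ̄` are the constants
given by the Möbius function. -/
theorem right_KLS_inverse_kernel_eq_mu {P : Type*} [PartialOrder P] [LocallyFiniteOrder P]
    [DecidableEq P] {rk : P → ℕ} (hrk : StrictMono rk) (R : P → P → ℤ[X])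
    (hR_refl : ∀ x, R x x = 1)
    (hR_deg : ∀ x y, x < y → 2 * (R x y).degree < ((rk y - rk x : ℕ) : WithBot ℕ))
    (hR_rec : ∀ x z, x < z → reflect (rk z - rk x) (R x z) =
      ∑ y ∈ Finset.Icc x z,
        (∑ w ∈ Finset.Icc x y, C (mu ℤ x w) * X ^ (rk w - rk x)) * R y z) (z : P) :
    ∀ x, x ≤ z → R x z = C (mu ℤ x z) := by
  suffices ∀ (k : ℕ) (x : P), rk z - rk x = k → x ≤ z → R x z = C (mu ℤ x z) from
    fun x => this _ x rfl
  intro k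
  induction k using Nat.strong_induction_on with
  | _ k ih =>
    intro x hk hxz
    rcases hxz.eq_or_lt with rfl | hlt
    · simp [hR_refl]
    have hrec := hR_rec x z hlt
    have hmu := sum_inverse_kernel_mul_mu rk hxz
    have htail : ∀ y ∈ Finset.Ioc x z, R y z = C (mu ℤ y z) := fun y hy => by
      obtain ⟨hxy, hyz⟩ := Finset.mem_Ioc.1 hy
      have h1 := hrk hxy
      have h2 := hrk.monotone hyz
      exact ih _ (by omega) y rfl hyz
    rw [Finset.Icc_eq_cons_Ioc hxz, Finset.sum_cons] at hrec hmu
    rw [Finset.sum_congr (s₁ := Finset.Ioc x z) rfl fun y hy =>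
      congrArg (_ * ·) (htail y hy)] at hrec
    simp only [Finset.Icc_self, Finset.sum_singleton, mu_self, map_one, tsub_self, pow_zero,
      mul_one, one_mul] at hrec hmu
    rw [← sub_eq_zero]
    refine eq_zero_of_reflect_eq_self (n := rk z - rk x) (fun i hi => ?_) ?_
    · have hpos := hrk hlt
      have hR : (R x z).coeff i = 0 := by
        by_contra hne
        have hd := hR_deg x z hlt
        rw [degree_eq_natDegree fun h => hne (by simp [h])] at hd
        have := le_natDegree_of_ne_zero hne
        norm_cast at hd
        omega
      rw [coeff_sub, hR, coeff_C_of_ne_zero (by omega), sub_zero]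
    · rw [reflect_sub, reflect_C, hrec, ← hmu]
      ring


/-- Let `L` be a finite geometric lattice with rank function `rk` and
Möbius function `μ`, and let `(R_{xy})_{x ≤ y}` be a family of polynomials in `ℤ[t]`
satisfying: (i) `R_{xx} = 1`; (ii) `deg R_{xy} < rk[x,y]/2` for `x < y`; and
(iii) for all `x < z`,
`t^{rk[x,z]} R_{xz}(1/t) = ∑_{x ≤ y ≤ z} χ̄_{xy}(t) R_{yz}(t)`, where
`χ̄_{xy}(t) = ∑_{x ≤ w ≤ y} μ(x,w) t^{rk[x,w]}` is the inverse kernel of `χ`.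
(These are the right Kazhdan–Lusztig–Stanley polynomials of the kernel `χ̄`; up to the
sign `(-1)^{rk[x,y]}` they are the inverse Kazhdan–Lusztig polynomials of the intervals
of `L`.)  Then for all `x ≤ y`, every coefficient of `(-1)^{rk[x,y]} · R_{xy}` is
nonnegative. -/
theorem inverse_right_KLS_polynomials_of_geometric_lattice_sign_nonneg
    {L : Type*} [Lattice L] [BoundedOrder L] [Fintype L] [LocallyFiniteOrder L]
    (hAtomistic : ∀ x : L, ∃ s : Finset L, (∀ a ∈ s, IsAtom a) ∧ x = s.sup id)
    (hUpperSemimodular : ∀ a b : L, a ⊓ b ⋖ b → a ⋖ a ⊔ b)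
    (rk : L → ℕ) (hrk_bot : rk ⊥ = 0)
    (hrk_cov : ∀ x y : L, x ⋖ y → rk y = rk x + 1)
    (μ : L → L → ℤ)
    (hμ_refl : ∀ x : L, μ x x = 1)
    (hμ_sum : ∀ x y : L, x < y → ∑ w ∈ Finset.Icc x y, μ x w = 0)
    (R : L → L → Polynomial ℤ)
    (hR_refl : ∀ x : L, R x x = 1)
    (hR_deg : ∀ x y : L, x < y →
      2 * (R x y).degree < ((rk y - rk x : ℕ) : WithBot ℕ))
    (hR_rec : ∀ x z : L, x < z →
      Polynomial.reflect (rk z - rk x) (R x z)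
        = ∑ y ∈ Finset.Icc x z,
            (∑ w ∈ Finset.Icc x y, Polynomial.C (μ x w) * Polynomial.X ^ (rk w - rk x)) *
              R y z) :
    ∀ x y : L, x ≤ y → ∀ n : ℕ, 0 ≤ (-1 : ℤ) ^ (rk y - rk x) * (R x y).coeff n := by
  classical
  have hμ := eq_mu_of_sum_Icc_eq_zero μ hμ_refl hμ_sum
  have hrk := strictMono_of_covBy_eq_add_one hrk_cov
  intro x y hxy n
  have hR := right_KLS_inverse_kernel_eq_mu hrk R hR_refl hR_deg (fun x z hxz => by
    rw [hR_rec x z hxz]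
    refine Finset.sum_congr rfl fun y _ => congrArg (· * R y z) ?_
    exact Finset.sum_congr rfl fun w hw => by rw [hμ x w (Finset.mem_Icc.1 hw).1]) y x hxy
  rw [hR, Polynomial.coeff_C]
  split_ifs
  · exact neg_one_pow_mul_mu_nonneg hUpperSemimodular hrk_cov y hxy
  · simp
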